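/- Let (Ω, 𝓕, P) be a probability space and f : Ω → ℝ^d a Bochner-integrable (strongly measurable and integrable) function, and let A ⊆ Ω be a measurable set with P(A) = 1. Then there exist an integer n with 1 ≤ n ≤ d + 1, points u_1, …, u_n ∈ A, and nonnegative real weights w_1, …, w_n with ∑_{k=1}^n w_k = 1 such that ∫_Ω f dP = ∑_{k=1}^n w_k · f(u_k). (This is the discrete mean representation used in the proof of Lemma ctf_cp3, obtained by combining the barycenter-in-convex-hull property with Carathéodory's theorem.) -/

import Mathlib

open MeasureTheory

/-- A nonempty convex set which is not a neighbourhood of `x` in a finite-dimensional space lies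
weakly on one side of `x`, or in a proper affine subspace. -/
theorem Convex.exists_ne_zero_forall_le_or_forall_eq {E : Type*} [NormedAddCommGroup E]
    [NormedSpace ℝ E] [FiniteDimensional ℝ E] {S : Set E} (hS : Convex ℝ S)
    (hne : S.Nonempty) {x : E} (hx : x ∉ interior S) :
    ∃ l : E →L[ℝ] ℝ, l ≠ 0 ∧ ((∀ a ∈ S, l a ≤ l x) ∨ ∀ a ∈ S, ∀ b ∈ S, l a = l b) := by
  by_cases hint : (interior S).Nonempty
  · obtain ⟨l, hl, h⟩ := geometric_hahn_banach_of_nonempty_interior_point hS hx hint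
    exact ⟨l, hl, Or.inl h⟩
  · have hspan : affineSpan ℝ S ≠ ⊤ :=
      fun h => hint (hS.interior_nonempty_iff_affineSpan_eq_top.2 h)
    have hdir : (affineSpan ℝ S).direction < ⊤ := by
      refine lt_top_iff_ne_top.2 fun h => hspan ?_
      exact (AffineSubspace.direction_eq_top_iff_of_nonempty
        ((affineSpan_nonempty ℝ).2 hne)).1 h
    obtain ⟨l, hl, hker⟩ := Submodule.exists_le_ker_of_lt_top _ hdir
    refine ⟨l.toContinuousLinearMap, by simpa using hl, Or.inr fun a ha b hb => ?_⟩
    have := hker (AffineSubspace.vsub_mem_direction (subset_affineSpan ℝ S ha)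
      (subset_affineSpan ℝ S hb))
    simpa [sub_eq_zero] using this

/-- In a finite-dimensional space, the mean of a random variable valued in a convex set belongs to
that set, which need not be closed. -/
theorem Convex.integral_mem_of_finiteDimensional {Ω : Type*} [MeasurableSpace Ω] {P : Measure Ω}
    [IsProbabilityMeasure P] {E : Type*} [NormedAddCommGroup E] [NormedSpace ℝ E]
    [FiniteDimensional ℝ E] {S : Set E} (hS : Convex ℝ S) {f : Ω → E} (hf : Integrable f P)
    (hfS : ∀ᵐ ω ∂P, f ω ∈ S) : ∫ ω, f ω ∂P ∈ S := by
  induction hn : Module.finrank ℝ E using Nat.strong_induction_on generalizing E with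
  | _ n ih =>
  by_contra hxS
  set x := ∫ ω, f ω ∂P with hx
  obtain ⟨l, hl, hle⟩ :=
    hS.exists_ne_zero_forall_le_or_forall_eq (hfS.exists.imp' f fun _ h => h)
      fun h => hxS (interior_subset h)
  have hlx : ∫ ω, l (f ω) ∂P = l x := l.integral_comp_comm hf
  have hlf : ∀ᵐ ω ∂P, l (f ω) = l x := by
    rcases hle with hle | heq
    · have h0 : ∫ ω, (l x - l (f ω)) ∂P = 0 := by
        rw [integral_sub (integrable_const _) (l.integrable_comp hf), hlx]
        simp
      rw [integral_eq_zero_iff_of_nonneg_ae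
        (hfS.mono fun ω h => sub_nonneg.2 (hle _ h))
        ((integrable_const _).sub (l.integrable_comp hf))] at h0
      exact h0.mono fun ω h => (sub_eq_zero.1 h).symm
    · obtain ⟨ω₀, h₀⟩ := hfS.exists
      have hc : ∀ᵐ ω ∂P, l (f ω) = l (f ω₀) := hfS.mono fun ω h => heq _ h _ h₀
      have hxc : l x = l (f ω₀) := by
        rw [← hlx, integral_congr_ae hc]
        simp
      rwa [hxc]
  let K := l.toLinearMap.ker
  obtain ⟨p, hp⟩ := K.subtype.exists_leftInverse_of_injective K.ker_subtype
  let q : E →L[ℝ] K := p.toContinuousLinearMap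
  have hq (v : E) (hv : l v = 0) : (q v : E) = v :=
    congrArg Subtype.val (LinearMap.congr_fun hp (⟨v, hv⟩ : K))
  have hfx : Integrable (fun ω => f ω - x) P := hf.sub (integrable_const _)
  have hK : Module.finrank ℝ K < n := by
    rw [← hn]
    refine Submodule.finrank_lt fun h => hl ?_
    ext v
    have : v ∈ K := h ▸ Submodule.mem_top
    simpa [K] using this
  have hmem := ih _ hK ((hS.translate_preimage_right x).linear_preimage K.subtype)
    (q.integrable_comp hfx)
    (by
      filter_upwards [hfS, hlf] with ω h₁ h₂
      have h₃ := hq (f ω - x) (by simp [h₂])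
      change x + (q (f ω - x) : E) ∈ S
      rwa [h₃, add_sub_cancel]) rfl
  rw [q.integral_comp_comm hfx, integral_sub hf (integrable_const _)] at hmem
  apply hxS
  simpa [← hx] using hmem

/-- **discrete mean representation.**  For a probability space `(Ω, P)`,
a Bochner-integrable `f : Ω → ℝ^d`, and a measurable set `A` with `P A = 1`, the mean
`∫ f dP` is a convex combination of at most `d + 1` values of `f` at points of `A`. -/
theorem integral_eq_convex_combination_of_values
    {Ω : Type*} [MeasurableSpace Ω] (P : Measure Ω) [IsProbabilityMeasure P]
    {d : ℕ} (f : Ω → EuclideanSpace ℝ (Fin d)) (hf : Integrable f P)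
    (A : Set Ω) (hA : MeasurableSet A) (hPA : P A = 1) :
    ∃ n : ℕ, 1 ≤ n ∧ n ≤ d + 1 ∧
      ∃ (u : Fin n → Ω) (w : Fin n → ℝ),
        (∀ k, u k ∈ A) ∧ (∀ k, 0 ≤ w k) ∧ (∑ k, w k = 1) ∧
        (∫ ω, f ω ∂P) = ∑ k, w k • f (u k) := by
  have hAe : ∀ᵐ ω ∂P, ω ∈ A := (mem_ae_iff_prob_eq_one hA).2 hPA
  have hmem : ∫ ω, f ω ∂P ∈ convexHull ℝ (f '' A) :=
    (convex_convexHull ℝ _).integral_mem_of_finiteDimensional hf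
      (hAe.mono fun ω h => subset_convexHull ℝ _ (Set.mem_image_of_mem f h))
  obtain ⟨ι, _, z, w, hz, hind, hw, hsum, hwz⟩ := eq_pos_convex_span_of_mem_convexHull hmem
  choose u huA huz using fun i => hz (Set.mem_range_self i)
  let e := (Fintype.equivFin ι).symm
  have hι : Nonempty ι := by
    by_contra h
    rw [not_nonempty_iff] at h
    simp at hsum
  refine ⟨Fintype.card ι, Fintype.card_pos, ?_, u ∘ e, w ∘ e, fun k => huA _,
    fun k => (hw _).le, ?_, ?_⟩
  · calc Fintype.card ι ≤ Module.finrank ℝ (vectorSpan ℝ (Set.range z)) + 1 :=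
        hind.card_le_finrank_succ
      _ ≤ d + 1 := by
        gcongr
        simpa using Submodule.finrank_le (vectorSpan ℝ (Set.range z))
  · rw [← hsum]
    exact e.sum_comp w
  · rw [← hwz, ← e.sum_comp]
    simp [huz]
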